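/- arXiv:2508.07222 — 2 statements merged into one kernel-verified Lean document; each statement's English description precedes it below -/
import Mathlib

section
/- Let n, m be positive integers and J a natural number. Let K : (Fin n → ℝ) → Matrix (Fin m) (Fin m) ℝ be differentiable at x* with K(x*) invertible, and u : (Fin n → ℝ) → (Fin m → ℝ) be differentiable at x*. Define f_eq(x) := K(x) *ᵥ u(x) and the F-ESL displacement linearized at x*: ũ(x) := (K(x))⁻¹ *ᵥ (f_eq(x*) + (fderiv ℝ f_eq x*) (x − x*)). Let f_c : (Fin n → ℝ) × (Fin m → ℝ) → ℝ and g : Fin J → ((Fin n → ℝ) × (Fin m → ℝ) → ℝ) be differentiable at (x*, u(x*)), and λ : Fin J → ℝ. If (x*, λ) satisfies the KKT conditions (stationarity of the Lagrangian, primal feasibility g j ≤ 0, dual feasibility λ j ≥ 0, and complementarity λ j · g j = 0) of the F-ESL static sub-problem (with displacements ũ), then (x*, λ) satisfies the KKT conditions of the original dynamic-response problem (with displacements u). In other words, a converged F-ESL solution that is a KKT point of its own sub-problem is a KKT point of the original problem. -/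
open scoped Matrix

attribute [local instance] Matrix.normedAddCommGroup Matrix.normedSpace

open scoped Topology

/-- A matrix-valued map that is bounded entrywise preserves little-o under `mulVec`. -/
theorem isLittleO_mulVec {F α : Type*} {m p : Type*}
    [NormedAddCommGroup F] [Fintype m] [Fintype p] {l : Filter α} {A : α → Matrix m p ℝ}
    {v : α → p → ℝ} {w : α → F}
    (hA : ∀ i j, (fun x => A x i j) =O[l] fun _ => (1 : ℝ)) (hv : v =o[l] w) :
    (fun x => A x *ᵥ v x) =o[l] w := by
  refine Asymptotics.isLittleO_pi.2 fun i => ?_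
  refine Asymptotics.IsLittleO.fun_sum (A := fun j x => A x i j * v x j) fun j _ => ?_
  simpa using ((hA i j).mul_isLittleO (Asymptotics.isLittleO_pi.1 hv j).norm_right).norm_right

theorem DifferentiableAt.matrix_mulVec {E : Type*} [NormedAddCommGroup E] [NormedSpace ℝ E]
    {m p : Type*} [Fintype m] [Fintype p] {A : E → Matrix m p ℝ} {v : E → p → ℝ} {x : E}
    (hA : DifferentiableAt ℝ A x) (hv : DifferentiableAt ℝ v x) :
    DifferentiableAt ℝ (fun y => A y *ᵥ v y) x := by
  refine differentiableAt_pi.2 fun i => ?_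
  refine DifferentiableAt.fun_sum (A := fun j y => A y i j * v y j) fun j _ => ?_
  exact (differentiableAt_pi.1 (differentiableAt_pi.1 hA i) j).mul (differentiableAt_pi.1 hv j)

theorem ContinuousAt.matrix_inv {X : Type*} [TopologicalSpace X] {m : Type*} [Fintype m]
    [DecidableEq m] {A : X → Matrix m m ℝ} {x : X} (hA : ContinuousAt A x)
    (hdet : IsUnit (A x).det) : ContinuousAt (fun y => (A y)⁻¹) x := by
  have hd : ContinuousAt (fun y => (A y).det) x :=
    (continuous_id.matrix_det (R := ℝ)).continuousAt.comp hA
  have ha : ContinuousAt (fun y => (A y).adjugate) x :=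
    (continuous_id.matrix_adjugate (R := ℝ)).continuousAt.comp hA
  simp only [Matrix.inv_def, Ring.inverse_eq_inv']
  exact (hd.inv₀ hdet.ne_zero).smul ha

/-- Solving the system `A y` against the linearization of `A y *ᵥ v y` recovers `v` to first
order. -/
theorem HasFDerivAt.inv_mulVec_linearization {E : Type*} [NormedAddCommGroup E] [NormedSpace ℝ E]
    {m : Type*} [Fintype m] [DecidableEq m] {A : E → Matrix m m ℝ} {v : E → m → ℝ} {x : E}
    {v' : E →L[ℝ] m → ℝ} {f' : E →L[ℝ] m → ℝ} (hA : ContinuousAt A x)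
    (hdet : IsUnit (A x).det) (hv : HasFDerivAt v v' x)
    (hf : HasFDerivAt (fun y => A y *ᵥ v y) f' x) :
    HasFDerivAt (fun y => (A y)⁻¹ *ᵥ (A x *ᵥ v x + f' (y - x))) v' x := by
  have hinv := hA.matrix_inv hdet
  have hbdd : ∀ i j, (fun y => (A y)⁻¹ i j) =O[𝓝 x] fun _ => (1 : ℝ) := fun i j =>
    ((continuousAt_pi.1 (continuousAt_pi.1 hinv i) j).tendsto).isBigO_one ℝ
  have hunit : ∀ᶠ y in 𝓝 x, IsUnit (A y).det := by
    have hd : ContinuousAt (fun y => (A y).det) x :=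
      (continuous_id.matrix_det (R := ℝ)).continuousAt.comp hA
    filter_upwards [hd.eventually_ne hdet.ne_zero] with y hy using hy.isUnit
  have hval : (A x)⁻¹ *ᵥ (A x *ᵥ v x + f' (x - x)) = v x := by
    simp [Matrix.nonsing_inv_mul _ hdet]
  refine .of_isLittleO ?_
  have hres := hv.isLittleO.sub (isLittleO_mulVec hbdd hf.isLittleO)
  refine hres.congr' ?_ .rfl
  filter_upwards [hunit] with y hy
  rw [hval]
  simp only [Matrix.mulVec_sub, Matrix.mulVec_add, Matrix.mulVec_mulVec,
    Matrix.nonsing_inv_mul _ hy, Matrix.one_mulVec]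
  abel

/-- A converged F-ESL solution that is a KKT point of its own static sub-problem is a
KKT point of the original dynamic-response problem (same Lagrange multipliers). -/
theorem fesl_kkt_transfer (n m : ℕ) (hn : 0 < n) (hm : 0 < m) (J : ℕ)
    (K : (Fin n → ℝ) → Matrix (Fin m) (Fin m) ℝ)
    (u : (Fin n → ℝ) → (Fin m → ℝ)) (xs : Fin n → ℝ)
    (hK : DifferentiableAt ℝ K xs) (hKinv : IsUnit (K xs).det)
    (hu : DifferentiableAt ℝ u xs)
    (f_eq : (Fin n → ℝ) → (Fin m → ℝ))
    (hf : f_eq = fun x => K x *ᵥ u x)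
    (ut : (Fin n → ℝ) → (Fin m → ℝ))
    (hut : ut = fun x => (K x)⁻¹ *ᵥ (f_eq xs + (fderiv ℝ f_eq xs) (x - xs)))
    (f_c : (Fin n → ℝ) × (Fin m → ℝ) → ℝ)
    (g : Fin J → ((Fin n → ℝ) × (Fin m → ℝ) → ℝ))
    (hfc : DifferentiableAt ℝ f_c (xs, u xs))
    (hg : ∀ j, DifferentiableAt ℝ (g j) (xs, u xs))
    (lam : Fin J → ℝ)
    (hstat : fderiv ℝ (fun x => f_c (x, ut x) + ∑ j, lam j * (g j) (x, ut x)) xs = 0)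
    (hprimal : ∀ j, (g j) (xs, ut xs) ≤ 0)
    (hdual : ∀ j, 0 ≤ lam j)
    (hcompl : ∀ j, lam j * (g j) (xs, ut xs) = 0) :
    fderiv ℝ (fun x => f_c (x, u x) + ∑ j, lam j * (g j) (x, u x)) xs = 0 ∧
      (∀ j, (g j) (xs, u xs) ≤ 0) ∧
      (∀ j, 0 ≤ lam j) ∧
      (∀ j, lam j * (g j) (xs, u xs) = 0) := by
  have hfd : DifferentiableAt ℝ f_eq xs := hf ▸ hK.matrix_mulVec hu
  have hfeq : f_eq xs = K xs *ᵥ u xs := by rw [hf]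
  have hutd : HasFDerivAt ut (fderiv ℝ u xs) xs := by
    rw [hut, hfeq]
    exact hu.hasFDerivAt.inv_mulVec_linearization hK.continuousAt hKinv (hf ▸ hfd.hasFDerivAt)
  have hval : ut xs = u xs := by
    rw [hut, hfeq]
    simp [Matrix.nonsing_inv_mul _ hKinv]
  have hlag : DifferentiableAt ℝ (fun p => f_c p + ∑ j, lam j * g j p) (xs, u xs) :=
    hfc.add (DifferentiableAt.fun_sum fun j _ => (hg j).const_mul (lam j))
  have hu_comp := hlag.hasFDerivAt.comp xs ((hasFDerivAt_id xs).prodMk hu.hasFDerivAt)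
  have hut_comp := HasFDerivAt.comp xs (g := fun p => f_c p + ∑ j, lam j * g j p)
    (f := fun x => (x, ut x)) (hval.symm ▸ hlag.hasFDerivAt) ((hasFDerivAt_id xs).prodMk hutd)
  rw [hval] at hut_comp
  refine ⟨?_, fun j => hval ▸ hprimal j, hdual, fun j => hval ▸ hcompl j⟩
  exact hu_comp.fderiv.trans (hut_comp.fderiv.symm.trans hstat)
end

section
/- Let m be a positive integer. Let u : ℝ × ℝ → (Fin m → ℝ) be three times continuously differentiable (ContDiff ℝ 3 as a function of the pair (x, t), where x is a scalar design variable and t is time). Let M, C, K : ℝ → Matrix (Fin m) (Fin m) ℝ be differentiable at x₀, and let p : ℝ × ℝ → (Fin m → ℝ) be such that for each t the map x ↦ p(x, t) is differentiable at x₀. Write u̇(x,t) and ü(x,t) for the first and second derivatives of t ↦ u(x,t), and suppose the equations of motion hold: for all x and t, M(x) *ᵥ ü(x,t) + C(x) *ᵥ u̇(x,t) + K(x) *ᵥ u(x,t) = p(x,t). Define the displacement sensitivity λ(x,t) := deriv (fun y => u(y,t)) x. Then for all t, M(x₀) *ᵥ (∂²ₜ λ)(x₀,t) + C(x₀) *ᵥ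 (∂ₜ λ)(x₀,t) + K(x₀) *ᵥ λ(x₀,t) = −(deriv M x₀) *ᵥ ü(x₀,t) − (deriv C x₀) *ᵥ u̇(x₀,t) − (deriv K x₀) *ᵥ u(x₀,t) + deriv (fun y => p(y,t)) x₀, where ∂ₜ λ and ∂²ₜ λ denote the first and second time derivatives of t ↦ λ(x₀,t). Moreover, if u(x,0) = 0 and u̇(x,0) = 0 for all x, then λ(x₀,0) = 0 and (∂ₜ λ)(x₀,0) = 0. -/
open scoped Matrix

attribute [local instance] Matrix.normedAddCommGroup Matrix.normedSpace

section PartialDerivatives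

variable {E : Type*} [NormedAddCommGroup E] [NormedSpace ℝ E]

theorem hasDerivAt_prodMk_left {f : ℝ × ℝ → E} (hf : Differentiable ℝ f) (x t : ℝ) :
    HasDerivAt (fun y => f (y, t)) (fderiv ℝ f (x, t) (1, 0)) x :=
  (hf (x, t)).hasFDerivAt.comp_hasDerivAt x ((hasDerivAt_id x).prodMk (hasDerivAt_const x t))

theorem hasDerivAt_prodMk_right {f : ℝ × ℝ → E} (hf : Differentiable ℝ f) (x t : ℝ) :
    HasDerivAt (fun s => f (x, s)) (fderiv ℝ f (x, t) (0, 1)) t :=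
  (hf (x, t)).hasFDerivAt.comp_hasDerivAt t ((hasDerivAt_const t x).prodMk (hasDerivAt_id t))

theorem ContDiff.fderiv_apply_const {F : Type*} [NormedAddCommGroup F] [NormedSpace ℝ F]
    {f : F → E} {n k : WithTop ℕ∞} (hf : ContDiff ℝ n f) (hk : k + 1 ≤ n) (v : F) :
    ContDiff ℝ k (fun z => fderiv ℝ f z v) :=
  (hf.fderiv_right hk).clm_apply contDiff_const

theorem ContDiff.fderiv_fderiv_apply_comm {F : Type*} [NormedAddCommGroup F] [NormedSpace ℝ F]
    {f : F → E} (hf : ContDiff ℝ 2 f) (z v w : F) :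
    fderiv ℝ (fun z => fderiv ℝ f z v) z w = fderiv ℝ (fun z => fderiv ℝ f z w) z v := by
  have hd : DifferentiableAt ℝ (fderiv ℝ f) z :=
    (hf.fderiv_right (m := 1) (by norm_num)).differentiable one_ne_zero z
  have hsymm : IsSymmSndFDerivAt ℝ f z := hf.contDiffAt.isSymmSndFDerivAt (by simp)
  rw [fderiv_clm_apply hd (differentiableAt_const v),
    fderiv_clm_apply hd (differentiableAt_const w)]
  simpa using hsymm.eq w v

end PartialDerivatives

theorem HasDerivAt.matrix_mulVec {m n : ℕ} {A : ℝ → Matrix (Fin m) (Fin n) ℝ}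
    {A' : Matrix (Fin m) (Fin n) ℝ} {v : ℝ → Fin n → ℝ} {v' : Fin n → ℝ} {x : ℝ}
    (hA : HasDerivAt A A' x) (hv : HasDerivAt v v' x) :
    HasDerivAt (fun y => A y *ᵥ v y) (A' *ᵥ v x + A x *ᵥ v') x := by
  rw [hasDerivAt_pi]
  intro i
  have hentry (j : Fin n) : HasDerivAt (fun y => A y i j) (A' i j) x :=
    (Matrix.entryLinearMap ℝ ℝ i j).toContinuousLinearMap.hasFDerivAt.comp_hasDerivAt x hA
  have hsum := HasDerivAt.fun_sum (u := Finset.univ)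
    fun j _ => (hentry j).mul (hasDerivAt_pi.1 hv j)
  simpa [Matrix.mulVec, dotProduct, Finset.sum_add_distrib] using hsum

/-- Direct sensitivity analysis: the displacement sensitivities `λ = ∂u/∂x` satisfy an
auxiliary second-order system with the same coefficient matrices, with the pseudo-load
`−M' ü − C' u̇ − K' u + ∂p/∂x`, and homogeneous initial conditions when the
displacements start at rest for every design. -/
theorem direct_sensitivity_analysis (m : ℕ) (hm : 0 < m)
    (u : ℝ × ℝ → (Fin m → ℝ)) (hu : ContDiff ℝ 3 u)
    (M C K : ℝ → Matrix (Fin m) (Fin m) ℝ) (x₀ : ℝ)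
    (hM : DifferentiableAt ℝ M x₀) (hC : DifferentiableAt ℝ C x₀)
    (hK : DifferentiableAt ℝ K x₀)
    (p : ℝ × ℝ → (Fin m → ℝ))
    (hp : ∀ t, DifferentiableAt ℝ (fun y => p (y, t)) x₀)
    (udot uddot : ℝ × ℝ → (Fin m → ℝ))
    (hudot : ∀ x t, udot (x, t) = deriv (fun s => u (x, s)) t)
    (huddot : ∀ x t, uddot (x, t) = deriv (fun s => udot (x, s)) t)
    (heom : ∀ x t, M x *ᵥ uddot (x, t) + C x *ᵥ udot (x, t) + K x *ᵥ u (x, t) = p (x, t))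
    (lam : ℝ × ℝ → (Fin m → ℝ))
    (hlam : ∀ x t, lam (x, t) = deriv (fun y => u (y, t)) x) :
    (∀ t, M x₀ *ᵥ deriv (fun s => deriv (fun s' => lam (x₀, s')) s) t
        + C x₀ *ᵥ deriv (fun s => lam (x₀, s)) t
        + K x₀ *ᵥ lam (x₀, t)
      = -(deriv M x₀ *ᵥ uddot (x₀, t)) - (deriv C x₀ *ᵥ udot (x₀, t))
        - (deriv K x₀ *ᵥ u (x₀, t)) + deriv (fun y => p (y, t)) x₀) ∧
    ((∀ x, u (x, 0) = 0) → (∀ x, udot (x, 0) = 0) →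
      lam (x₀, 0) = 0 ∧ deriv (fun s => lam (x₀, s)) 0 = 0) := by
  have hudot_eq : udot = fun z => fderiv ℝ u z (0, 1) := by
    funext ⟨x, t⟩
    rw [hudot, (hasDerivAt_prodMk_right (hu.differentiable (by norm_num)) x t).deriv]
  have hlam_eq : lam = fun z => fderiv ℝ u z (1, 0) := by
    funext ⟨x, t⟩
    rw [hlam, (hasDerivAt_prodMk_left (hu.differentiable (by norm_num)) x t).deriv]
  have hudot_smooth : ContDiff ℝ 2 udot := by
    rw [hudot_eq]
    exact hu.fderiv_apply_const (by norm_num) _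
  have hlam_diff : Differentiable ℝ lam := by
    rw [hlam_eq]
    exact (hu.fderiv_apply_const (k := 2) (by norm_num) _).differentiable (by norm_num)
  have hudot_diff : Differentiable ℝ udot := hudot_smooth.differentiable (by norm_num)
  have huddot_eq : uddot = fun z => fderiv ℝ udot z (0, 1) := by
    funext ⟨x, t⟩
    rw [huddot, (hasDerivAt_prodMk_right hudot_diff x t).deriv]
  have huddot_diff : Differentiable ℝ uddot := by
    rw [huddot_eq]
    exact (hudot_smooth.fderiv_apply_const (k := 1) (by norm_num) _).differentiable (by norm_num)
  have hlam_t (t : ℝ) : deriv (fun s => lam (x₀, s)) t = fderiv ℝ udot (x₀, t) (1, 0) := by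
    rw [(hasDerivAt_prodMk_right hlam_diff x₀ t).deriv, hlam_eq, hudot_eq]
    exact (hu.of_le (by norm_num)).fderiv_fderiv_apply_comm _ _ _
  have hlam_tt (t : ℝ) : deriv (fun s => deriv (fun s' => lam (x₀, s')) s) t
      = fderiv ℝ uddot (x₀, t) (1, 0) := by
    simp_rw [hlam_t]
    rw [(hasDerivAt_prodMk_right ((hudot_smooth.fderiv_apply_const (k := 1)
      (by norm_num) (1, 0)).differentiable (by norm_num)) x₀ t).deriv, huddot_eq]
    exact hudot_smooth.fderiv_fderiv_apply_comm _ _ _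
  refine ⟨fun t => ?_, fun hu0 hudot0 => ⟨by simp [hlam, hu0], ?_⟩⟩
  · have hu_x := hasDerivAt_prodMk_left (hu.differentiable (by norm_num)) x₀ t
    have hlhs := ((hM.hasDerivAt.matrix_mulVec (hasDerivAt_prodMk_left huddot_diff x₀ t)).add
      (hC.hasDerivAt.matrix_mulVec (hasDerivAt_prodMk_left hudot_diff x₀ t))).add
      (hK.hasDerivAt.matrix_mulVec hu_x)
    have hp_deriv : deriv (fun y => p (y, t)) x₀
        = deriv M x₀ *ᵥ uddot (x₀, t) + M x₀ *ᵥ fderiv ℝ uddot (x₀, t) (1, 0)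
        + (deriv C x₀ *ᵥ udot (x₀, t) + C x₀ *ᵥ fderiv ℝ udot (x₀, t) (1, 0))
        + (deriv K x₀ *ᵥ u (x₀, t) + K x₀ *ᵥ fderiv ℝ u (x₀, t) (1, 0)) := (hlhs.congr_of_eventuallyEq
      (Filter.Eventually.of_forall fun y => (heom y t).symm)).deriv
    rw [hlam_tt, hlam_t, hlam, hu_x.deriv, hp_deriv]
    abel
  · rw [hlam_t, ← (hasDerivAt_prodMk_left hudot_diff x₀ 0).deriv]
    simp [hudot0]
end
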